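/- arXiv:2001.08628 — 5 statements merged into one kernel-verified Lean document; each statement's English description precedes it below -/
import Mathlib

section
/- For all fixed integers 1 ≤ ℓ < k and every real ε > 0 there is an integer n₀ such that for every integer n ≥ n₀, ldim(Q(n; ℓ, k)) ≥ (1 − ε) · log log n. -/
open scoped Classical

namespace PaperLD

/-- A partial linear extension of a poset `α`: a duplicate-free list whose
listing order extends the partial order on the elements it contains. -/
structure PLE (α : Type*) [PartialOrder α] where
  toList : List α
  nodup : toList.Nodup
  le_imp : ∀ i j : Fin toList.length, toList.get i ≤ toList.get j → i ≤ j

/-- `x` occurs (weakly) before `y` in the partial linear extension `L`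
(in particular both `x` and `y` belong to the ground set of `L`). -/
def PLE.Before {α : Type*} [PartialOrder α] (L : PLE α) (x y : α) : Prop :=
  ∃ i j : Fin L.toList.length, i ≤ j ∧ L.toList.get i = x ∧ L.toList.get j = y

/-- A family of partial linear extensions is a local realiser if, for every
ordered pair `(x, y)` with `x ≱ y`, some member lists `x` before `y`. -/
def IsLocalRealiser {α : Type*} [PartialOrder α] {ι : Type*} (F : ι → PLE α) : Prop :=
  ∀ x y : α, ¬ y ≤ x → ∃ i, (F i).Before x y

/-- The multiplicity of `x` in a finite family of partial linear extensions:
the number of members whose ground set contains `x`. -/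
noncomputable def mult {α : Type*} [PartialOrder α] {N : ℕ} (F : Fin N → PLE α) (x : α) : ℕ :=
  (Finset.univ.filter fun i => x ∈ (F i).toList).card

/-- The local dimension of a finite poset: the least `d` such that there is a
local realiser in which every element has multiplicity at most `d`. -/
noncomputable def ldim (α : Type*) [PartialOrder α] [Fintype α] : ℕ :=
  sInf {d | ∃ (N : ℕ) (F : Fin N → PLE α), IsLocalRealiser F ∧ ∀ x : α, mult F x ≤ d}

/-- The order dimension of a finite poset: the least `d` such that some family of `d`
linear extensions (partial linear extensions containing every element) is a realiser. -/
noncomputable def odim (α : Type*) [PartialOrder α] [Fintype α] : ℕ :=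
  sInf {d | ∃ F : Fin d → PLE α, (∀ i, ∀ x : α, x ∈ (F i).toList) ∧ IsLocalRealiser F}

/-- `BoolLayers n ℓ k` is the suborder of the Boolean lattice `Q(n)` induced by the
`ℓ`-th and `k`-th layers: all subsets of an `n`-set of cardinality `ℓ` or `k`,
ordered by inclusion. -/
abbrev BoolLayers (n ℓ k : ℕ) := {s : Finset (Fin n) // s.card = ℓ ∨ s.card = k}

/-! ### Monotone subsequences -/

/-- If no monotone subset of `Y` has more than `r` elements, then the points of `Y` can be labelled
by `1, …, r` so that labels strictly increase along increasing pairs. -/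
lemma exists_label_of_card_le {V β : Type*} [LinearOrder V] [LinearOrder β] (Y : Finset V)
    (f : V → β) (r : ℕ) (h : ∀ T ⊆ Y, MonotoneOn f T → T.card ≤ r) :
    ∃ a : V → ℕ, (∀ y ∈ Y, a y ∈ Finset.Icc 1 r) ∧
      ∀ x ∈ Y, ∀ y ∈ Y, x < y → f x ≤ f y → a x < a y := by
  let C : V → Finset (Finset V) := fun y =>
    Y.powerset.filter fun T => MonotoneOn f T ∧ y ∈ T ∧ ∀ z ∈ T, z ≤ y
  have hC : ∀ y T, T ∈ C y ↔ T ⊆ Y ∧ MonotoneOn f T ∧ y ∈ T ∧ ∀ z ∈ T, z ≤ y := by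
    intro y T
    simp [C]
  have hsingle : ∀ y ∈ Y, {y} ∈ C y := by
    intro y hy
    rw [hC]
    simp [hy]
  refine ⟨fun y => (C y).sup Finset.card, fun y hy => ?_, fun x hx y hy hxy hf => ?_⟩
  · rw [Finset.mem_Icc]
    refine ⟨?_, Finset.sup_le fun T hT => h T ((hC _ _).1 hT).1 ((hC _ _).1 hT).2.1⟩
    simpa using Finset.le_sup (f := Finset.card) (hsingle y hy)
  · obtain ⟨T, hT, hTeq⟩ := Finset.exists_mem_eq_sup (C x) ⟨_, hsingle x hx⟩ Finset.card
    obtain ⟨hTY, hmono, hxT, hle⟩ := (hC _ _).1 hT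
    have hyT : y ∉ T := fun hyT => absurd (hle y hyT) (not_le.2 hxy)
    have hmem : insert y T ∈ C y := by
      rw [hC]
      refine ⟨Finset.insert_subset hy hTY, ?_, Finset.mem_insert_self _ _, ?_⟩
      · intro u hu v hv huv
        simp only [Finset.coe_insert, Set.mem_insert_iff, Finset.mem_coe] at hu hv
        rcases hu with rfl | hu <;> rcases hv with rfl | hv
        · exact le_rfl
        · exact absurd (huv.trans (hle v hv)) (not_le.2 hxy)
        · exact (hmono hu hxT (hle u hu)).trans hf
        · exact hmono hu hv huv
      · intro z hz
        rcases Finset.mem_insert.1 hz with rfl | hz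
        · exact le_rfl
        · exact (hle z hz).trans hxy.le
    have := Finset.le_sup (f := Finset.card) hmem
    rw [Finset.card_insert_of_notMem hyT] at this
    simp only [hTeq]
    omega

/-- The Erdős–Szekeres theorem. -/
lemma exists_monotoneOn_or_antitoneOn {V β : Type*} [LinearOrder V] [LinearOrder β]
    (Y : Finset V) (f : V → β) (r : ℕ) (h : r * r < Y.card) :
    ∃ T ⊆ Y, r < T.card ∧ (MonotoneOn f T ∨ AntitoneOn f T) := by
  by_contra! hno
  obtain ⟨a, ha, ha'⟩ := exists_label_of_card_le Y f r fun T hT hm => by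
    by_contra! hlt
    exact (hno T hT hlt).1 hm
  obtain ⟨b, hb, hb'⟩ := exists_label_of_card_le Y (OrderDual.toDual ∘ f) r fun T hT hm => by
    by_contra! hlt
    exact (hno T hT hlt).2 fun u hu v hv huv => hm hu hv huv
  have hne : ∀ x ∈ Y, ∀ y ∈ Y, x < y → (a x, b x) ≠ (a y, b y) := by
    intro x hx y hy hxy heq
    obtain ⟨h1, h2⟩ := Prod.mk.inj heq
    rcases le_total (f x) (f y) with hf | hf
    · exact (ha' x hx y hy hxy hf).ne h1
    · exact (hb' x hx y hy hxy hf).ne h2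
  have hcard : Y.card ≤ (Finset.Icc 1 r ×ˢ Finset.Icc 1 r).card := by
    refine Finset.card_le_card_of_injOn (fun y => (a y, b y))
      (fun y hy => Finset.mem_coe.2 (Finset.mem_product.2 ⟨ha y hy, hb y hy⟩)) ?_
    intro x hx y hy heq
    rcases lt_trichotomy x y with hxy | hxy | hxy
    · exact absurd heq (hne x hx y hy hxy)
    · exact hxy
    · exact absurd heq.symm (hne y hy x hx hxy)
  simp only [Finset.card_product, Nat.card_Icc, Nat.add_sub_cancel] at hcard
  omega

/-- The Erdős–Szekeres theorem for several functions simultaneously. -/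
lemma exists_forall_monotoneOn_or_antitoneOn {V β ι : Type*} [LinearOrder V] [LinearOrder β]
    (f : ι → V → β) (r : ℕ) (K : Finset ι) (Y : Finset V) (h : r ^ 2 ^ K.card < Y.card) :
    ∃ T ⊆ Y, r < T.card ∧ ∀ L ∈ K, MonotoneOn (f L) T ∨ AntitoneOn (f L) T := by
  induction K using Finset.induction_on generalizing Y with
  | empty => exact ⟨Y, subset_rfl, by simpa using h, by simp⟩
  | insert L K hL ih =>
    rw [Finset.card_insert_of_notMem hL, pow_succ, pow_mul, sq] at h
    obtain ⟨T, hTY, hT, hfT⟩ := exists_monotoneOn_or_antitoneOn Y (f L) _ h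
    obtain ⟨U, hUT, hU, hfU⟩ := ih T hT
    refine ⟨U, hUT.trans hTY, hU, fun M hM => ?_⟩
    rcases Finset.mem_insert.1 hM with rfl | hM
    · exact hfT.imp (fun h => h.mono (by exact_mod_cast hUT))
        (fun h => h.mono (by exact_mod_cast hUT))
    · exact hfU M hM

/-! ### Sunflowers -/

/-- The sunflower lemma for indexed families of sets with at most `d` elements each. -/
lemma exists_sunflower {V ι : Type*} (m D d : ℕ) (hd : d ≤ D) (X : Finset V)
    (S : V → Finset ι) (hS : ∀ v ∈ X, (S v).card ≤ d) (hX : m * (D * m + 1) ^ d ≤ X.card) :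
    ∃ Y ⊆ X, m ≤ Y.card ∧ ∃ K : Finset ι, (∀ v ∈ Y, K ⊆ S v) ∧
      ∀ u ∈ Y, ∀ v ∈ Y, u ≠ v → Disjoint (S u \ K) (S v \ K) := by
  induction d generalizing X S with
  | zero =>
    refine ⟨X, subset_rfl, by simpa using hX, ∅, by simp, fun u hu v _ _ => ?_⟩
    have : S u = ∅ := by simpa using hS u hu
    simp [this]
  | succ d ih =>
    let C : Finset (Finset V) :=
      X.powerset.filter fun Y => ∀ u ∈ Y, ∀ v ∈ Y, u ≠ v → Disjoint (S u) (S v)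
    obtain ⟨Y, hYC, hmax⟩ := C.exists_max_image Finset.card ⟨∅, by simp [C]⟩
    obtain ⟨hYX, hdisj⟩ : Y ⊆ X ∧ ∀ u ∈ Y, ∀ v ∈ Y, u ≠ v → Disjoint (S u) (S v) := by
      simpa [C] using hYC
    by_cases hYm : m ≤ Y.card
    · exact ⟨Y, hYX, hYm, ∅, by simp, by simpa using hdisj⟩
    push Not at hYm
    have hmeet : ∀ x ∈ X \ Y, ∃ a ∈ Y.biUnion S, a ∈ S x := by
      intro x hx
      obtain ⟨hxX, hxY⟩ := Finset.mem_sdiff.1 hx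
      by_contra! hno
      have hx' : ∀ v ∈ Y, Disjoint (S x) (S v) := fun v hv =>
        Finset.disjoint_left.2 fun a hax hav => hno a (Finset.mem_biUnion.2 ⟨v, hv, hav⟩) hax
      have hmem : insert x Y ∈ C := by
        simp only [C, Finset.mem_filter, Finset.mem_powerset]
        refine ⟨Finset.insert_subset hxX hYX, fun u hu v hv huv => ?_⟩
        rcases Finset.mem_insert.1 hu with hu' | hu' <;>
          rcases Finset.mem_insert.1 hv with hv' | hv'
        · exact absurd (hu'.trans hv'.symm) huv
        · exact hu' ▸ hx' v hv'
        · exact hv' ▸ (hx' u hu').symm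
        · exact hdisj u hu' v hv' huv
      have := hmax _ hmem
      rw [Finset.card_insert_of_notMem hxY] at this
      omega
    have hU : (Y.biUnion S).card ≤ D * m :=
      calc (Y.biUnion S).card ≤ Y.card * (d + 1) :=
            Finset.card_biUnion_le_card_mul _ _ _ fun v hv => hS v (hYX hv)
        _ ≤ m * D := Nat.mul_le_mul hYm.le hd
        _ = D * m := mul_comm _ _
    have hpow : 1 ≤ (D * m + 1) ^ d := Nat.one_le_pow _ _ (by omega)
    have hXY : (D * m) * (m * (D * m + 1) ^ d) ≤ (X \ Y).card := by
      rw [Finset.card_sdiff_of_subset hYX]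
      have : m * (D * m + 1) ^ (d + 1)
          = (D * m) * (m * (D * m + 1) ^ d) + m * (D * m + 1) ^ d := by ring
      have : m ≤ m * (D * m + 1) ^ d := Nat.le_mul_of_pos_right _ hpow
      omega
    have hne : (Y.biUnion S).Nonempty := by
      have hlt : 0 < (X \ Y).card := by
        rw [Finset.card_sdiff_of_subset hYX]
        have : m ≤ m * (D * m + 1) ^ (d + 1) :=
          Nat.le_mul_of_pos_right _ (Nat.one_le_pow _ _ (by omega))
        omega
      obtain ⟨x, hx⟩ := Finset.card_pos.1 hlt
      obtain ⟨a, ha, -⟩ := hmeet x hx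
      exact ⟨a, ha⟩
    have : Nonempty ι := hne.to_type
    choose! g hgU hgS using hmeet
    obtain ⟨a, -, ha⟩ := Finset.exists_le_card_fiber_of_mul_le_card_of_maps_to hgU hne
      ((Nat.mul_le_mul_right _ hU).trans hXY)
    have haS : ∀ x ∈ (X \ Y).filter (fun x => g x = a), a ∈ S x := by
      intro x hx
      obtain ⟨hx, hgx⟩ := Finset.mem_filter.1 hx
      exact hgx ▸ hgS x hx
    obtain ⟨Z, hZ, hZm, K, hK, hpet⟩ := ih (by omega) _ (fun v => (S v).erase a)
      (fun v hv => by
        have := hS v (Finset.mem_sdiff.1 (Finset.mem_filter.1 hv).1).1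
        rw [Finset.card_erase_of_mem (haS v hv)]
        omega) ha
    refine ⟨Z, hZ.trans ((Finset.filter_subset _ _).trans Finset.sdiff_subset), hZm, insert a K,
      fun v hv => Finset.insert_subset (haS v (hZ hv)) ((hK v hv).trans (Finset.erase_subset _ _)),
      fun u hu v hv huv => ?_⟩
    have herase : ∀ w, S w \ insert a K = (S w).erase a \ K := by
      intro w
      ext b
      simp only [Finset.mem_sdiff, Finset.mem_insert, Finset.mem_erase]
      tauto
    rw [herase, herase]
    exact hpet u hu v hv huv

/-! ### The main combinatorial bound -/

/-- Suppose every point of `X` and every pair of points lies in at most `d` of the labelled lists,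
and for all distinct `i`, `j`, `k` some list contains `j` and the pair `{i, k}`, with `j` listed
after those of `i` and `k` which it contains. Then `X` is at most doubly exponential in `d`. -/
lemma card_lt_of_pairs_below {V ι : Type*} [LinearOrder V] (d : ℕ) (X : Finset V)
    (S : V → Finset ι) (E : V → V → Finset ι) (pos : ι → V → ℕ)
    (hS : ∀ v ∈ X, (S v).card ≤ d) (hE : ∀ i ∈ X, ∀ k ∈ X, i < k → (E i k).card ≤ d)
    (hcov : ∀ i ∈ X, ∀ j ∈ X, ∀ k ∈ X, i < j → j < k → ∃ L ∈ E i k, L ∈ S j ∧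
      (L ∈ S i → pos L i < pos L j) ∧ (L ∈ S k → pos L k < pos L j)) :
    X.card < ((d + 2) ^ 2 ^ d + 1) * (d * ((d + 2) ^ 2 ^ d + 1) + 1) ^ d := by
  by_contra! hX
  obtain ⟨Y, hYX, hY, K, hK, hpet⟩ := exists_sunflower _ d d le_rfl X S hS hX
  have hKd : K.card ≤ d := by
    obtain ⟨v, hv⟩ := Finset.card_pos.1 (show 0 < Y.card by omega)
    exact (Finset.card_le_card (hK v hv)).trans (hS v (hYX hv))
  have hpow : (d + 2) ^ 2 ^ K.card ≤ (d + 2) ^ 2 ^ d :=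
    Nat.pow_le_pow_right (by omega) (Nat.pow_le_pow_right (by omega) hKd)
  obtain ⟨T, hTY, hT, hmono⟩ :=
    exists_forall_monotoneOn_or_antitoneOn pos (d + 2) K Y (by omega)
  have hTne : T.Nonempty := Finset.card_pos.1 (by omega)
  set i := T.min' hTne
  set k := T.max' hTne
  have hi : i ∈ T := T.min'_mem hTne
  have hk : k ∈ T := T.max'_mem hTne
  have hik : i < k := Finset.min'_lt_max'_of_card _ (by omega)
  set J := (T.erase i).erase k
  have hJ : d < J.card := by
    have h1 := Finset.card_erase_of_mem hi
    have h2 : J.card = (T.erase i).card - 1 :=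
      Finset.card_erase_of_mem (Finset.mem_erase.2 ⟨hik.ne', hk⟩)
    omega
  have hJT : ∀ j ∈ J, j ∈ T ∧ i < j ∧ j < k := by
    intro j hj
    obtain ⟨hjk, hj⟩ := Finset.mem_erase.1 hj
    obtain ⟨hji, hj⟩ := Finset.mem_erase.1 hj
    exact ⟨hj, lt_of_le_of_ne (T.min'_le j hj) (Ne.symm hji), lt_of_le_of_ne (T.le_max' j hj) hjk⟩
  have hpetal : ∀ j ∈ J, ∃ L ∈ E i k, L ∈ S j \ K := by
    intro j hj
    obtain ⟨hjT, hij, hjk⟩ := hJT j hj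
    obtain ⟨L, hLE, hLS, hLi, hLk⟩ :=
      hcov i (hYX (hTY hi)) j (hYX (hTY hjT)) k (hYX (hTY hk)) hij hjk
    refine ⟨L, hLE, Finset.mem_sdiff.2 ⟨hLS, fun hLK => ?_⟩⟩
    have h1 := hLi (hK i (hTY hi) hLK)
    have h2 := hLk (hK k (hTY hk) hLK)
    rcases hmono L hLK with hm | hm
    · exact absurd (hm hjT hk hjk.le) (by omega)
    · exact absurd (hm hi hjT hij.le) (by omega)
  have : Nonempty ι := by
    obtain ⟨j, hj⟩ := Finset.card_pos.1 (show 0 < J.card by omega)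
    exact ⟨(hpetal j hj).choose⟩
  choose! g hgE hgS using hpetal
  have hJE : J.card ≤ (E i k).card := by
    refine Finset.card_le_card_of_injOn g (fun j hj => hgE j hj) ?_
    intro u hu v hv huv
    by_contra hne
    refine Finset.disjoint_left.1 (hpet u (hTY (hJT u hu).1) v (hTY (hJT v hv).1) hne)
      (hgS u hu) ?_
    rw [huv]
    exact hgS v hv
  have := hE i (hYX (hTY hi)) k (hYX (hTY hk)) hik
  omega

/-! ### Local realisers -/

/-- The position of `x` in the partial linear extension `L`. -/
noncomputable def PLE.pos {α : Type*} [PartialOrder α] (L : PLE α) (x : α) : ℕ :=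
  L.toList.idxOf x

lemma PLE.pos_le_pos_of_le {α : Type*} [PartialOrder α] (L : PLE α) {x y : α}
    (hx : x ∈ L.toList) (hy : y ∈ L.toList) (h : x ≤ y) : L.pos x ≤ L.pos y :=
  L.le_imp ⟨_, List.idxOf_lt_length_of_mem hx⟩ ⟨_, List.idxOf_lt_length_of_mem hy⟩ (by simpa using h)

lemma PLE.eq_of_pos_eq {α : Type*} [PartialOrder α] (L : PLE α) {x y : α}
    (hx : x ∈ L.toList) (h : L.pos x = L.pos y) : x = y :=
  (List.idxOf_inj hx).1 h

lemma PLE.Before.mem_left {α : Type*} [PartialOrder α] {L : PLE α} {x y : α}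
    (h : L.Before x y) : x ∈ L.toList := by
  obtain ⟨i, j, -, rfl, rfl⟩ := h
  exact List.get_mem _ _

lemma PLE.Before.mem_right {α : Type*} [PartialOrder α] {L : PLE α} {x y : α}
    (h : L.Before x y) : y ∈ L.toList := by
  obtain ⟨i, j, -, rfl, rfl⟩ := h
  exact List.get_mem _ _

lemma PLE.Before.pos_le_pos {α : Type*} [PartialOrder α] {L : PLE α} {x y : α}
    (h : L.Before x y) : L.pos x ≤ L.pos y := by
  obtain ⟨i, j, hij, rfl, rfl⟩ := h
  rw [PLE.pos, PLE.pos, List.get_idxOf L.nodup, List.get_idxOf L.nodup]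
  exact hij

/-- The partial linear extension listing just `x` and then `y`. -/
def PLE.pair {α : Type*} [PartialOrder α] (x y : α) (h : ¬ y ≤ x) : PLE α where
  toList := [x, y]
  nodup := by
    have : x ≠ y := fun hxy => h hxy.ge
    simpa using this
  le_imp i j := by
    fin_cases i <;> fin_cases j <;> simp [h]

lemma PLE.pair_before {α : Type*} [PartialOrder α] (x y : α) (h : ¬ y ≤ x) :
    (PLE.pair x y h).Before x y :=
  ⟨⟨0, by simp [PLE.pair]⟩, ⟨1, by simp [PLE.pair]⟩, by simp, rfl, rfl⟩

lemma exists_isLocalRealiser (α : Type*) [PartialOrder α] [Fintype α] :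
    ∃ (N : ℕ) (F : Fin N → PLE α), IsLocalRealiser F := by
  let e := Fintype.equivFin {z : α × α // ¬ z.2 ≤ z.1}
  refine ⟨_, fun i => PLE.pair _ _ (e.symm i).2, fun x y h => ⟨e ⟨(x, y), h⟩, ?_⟩⟩
  simpa using PLE.pair_before x y h

lemma exists_isLocalRealiser_mult_le_ldim (α : Type*) [PartialOrder α] [Fintype α] :
    ∃ (N : ℕ) (F : Fin N → PLE α), IsLocalRealiser F ∧ ∀ x : α, mult F x ≤ ldim α := by
  obtain ⟨N, F, hF⟩ := exists_isLocalRealiser α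
  exact Nat.sInf_mem (s := {d | ∃ (N : ℕ) (F : Fin N → PLE α),
    IsLocalRealiser F ∧ ∀ x : α, mult F x ≤ d}) ⟨N, N, F, hF, fun x => by
      simpa [mult] using Finset.card_filter_le (Finset.univ : Finset (Fin N)) _⟩

/-- A poset of local dimension `d` which contains the incidence poset of a complete graph on the
vertex set `V` forces `V` to be at most doubly exponential in `d`. -/
lemma card_lt_of_ldim {α V : Type*} [PartialOrder α] [Fintype α] [LinearOrder V] [Fintype V]
    (p : V → α) (q : V → V → α) (hp : ∀ i k, i < k → p i ≤ q i k ∧ p k ≤ q i k)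
    (hq : ∀ i j k, i < j → j < k → ¬ p j ≤ q i k) :
    Fintype.card V < ((ldim α + 2) ^ 2 ^ ldim α + 1) *
      (ldim α * ((ldim α + 2) ^ 2 ^ ldim α + 1) + 1) ^ ldim α := by
  obtain ⟨N, F, hF, hmult⟩ := exists_isLocalRealiser_mult_le_ldim α
  refine card_lt_of_pairs_below (ldim α) Finset.univ
    (fun v => Finset.univ.filter fun L => p v ∈ (F L).toList)
    (fun i k => Finset.univ.filter fun L => q i k ∈ (F L).toList)
    (fun L v => (F L).pos (p v)) (fun v _ => hmult _) (fun i _ k _ _ => hmult _) ?_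
  intro i _ j _ k _ hij hjk
  obtain ⟨L, hL⟩ := hF (q i k) (p j) (hq i j k hij hjk)
  have hlt : ∀ v, p v ≤ q i k → p v ∈ (F L).toList → (F L).pos (p v) < (F L).pos (p j) := by
    intro v hv hvL
    refine lt_of_le_of_ne (((F L).pos_le_pos_of_le hvL hL.mem_left hv).trans hL.pos_le_pos) ?_
    intro h
    exact hq i j k hij hjk ((F L).eq_of_pos_eq hvL h ▸ hv)
  have hpik := hp i k (hij.trans hjk)
  refine ⟨L, by simpa using hL.mem_left, by simpa using hL.mem_right, ?_, ?_⟩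
  · simpa using hlt i hpik.1
  · simpa using hlt k hpik.2

lemma lt_of_ldim_boolLayers (n ℓ k : ℕ) (hℓ : 1 ≤ ℓ) (hℓk : ℓ < k) :
    n < ((ldim (BoolLayers n ℓ k) + 2) ^ 2 ^ ldim (BoolLayers n ℓ k) + 1) *
      (ldim (BoolLayers n ℓ k) * ((ldim (BoolLayers n ℓ k) + 2) ^ 2 ^ ldim (BoolLayers n ℓ k) + 1)
        + 1) ^ ldim (BoolLayers n ℓ k) + k := by
  rcases lt_or_ge n k with hnk | hkn
  · omega
  obtain ⟨C, -, hC⟩ := Finset.exists_subset_card_eq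
    (show k - 2 ≤ (Finset.univ : Finset (Fin n)).card by simp; omega)
  obtain ⟨A, hAC, hA⟩ := Finset.exists_subset_card_eq (show ℓ - 1 ≤ C.card by omega)
  let p : {v // v ∉ C} → BoolLayers n ℓ k := fun v =>
    ⟨insert v.1 A, Or.inl (by
      rw [Finset.card_insert_of_notMem fun h => v.2 (hAC h)]
      omega)⟩
  let q : {v // v ∉ C} → {v // v ∉ C} → BoolLayers n ℓ k := fun u v =>
    if h : u < v then ⟨insert u.1 (insert v.1 C), Or.inr (by
      rw [Finset.card_insert_of_notMem, Finset.card_insert_of_notMem v.2]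
      · omega
      · simpa [u.2] using fun h' => h.ne (Subtype.ext h'))⟩
    else p u
  have hqval : ∀ u v, u < v → (q u v).1 = insert u.1 (insert v.1 C) := by
    intro u v h
    simp [q, h]
  have hlt := card_lt_of_ldim p q
    (fun i k h => by
      constructor <;> rw [← Subtype.coe_le_coe, hqval i k h]
      · exact Finset.insert_subset_insert _ (hAC.trans (Finset.subset_insert _ _))
      · exact (Finset.insert_subset_insert _ hAC).trans (Finset.subset_insert _ _))
    (fun i j k hij hjk h => by
      rw [← Subtype.coe_le_coe, hqval i k (hij.trans hjk)] at h
      have hj := h (Finset.mem_insert_self j.1 A)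
      simp only [Finset.mem_insert, j.2, or_false] at hj
      rcases hj with hj | hj
      · exact hij.ne' (Subtype.ext hj)
      · exact hjk.ne (Subtype.ext hj))
  have hcard : Fintype.card {v // v ∉ C} = n - (k - 2) := by
    rw [Fintype.card_subtype_compl]
    simp [hC]
  omega

/-! ### Asymptotics -/

lemma double_exp_bound (d : ℕ) :
    ((d + 2) ^ 2 ^ d + 1) * (d * ((d + 2) ^ 2 ^ d + 1) + 1) ^ d ≤ 2 ^ ((d + 3) ^ 2 * 2 ^ d) := by
  have hd : d + 1 ≤ 2 ^ d := Nat.lt_two_pow_self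
  have hM : (d + 2) ^ 2 ^ d + 1 ≤ 2 ^ ((d + 2) * 2 ^ d) :=
    calc (d + 2) ^ 2 ^ d + 1 ≤ (2 ^ (d + 1)) ^ 2 ^ d + 1 := by
          gcongr
          rw [pow_succ]
          omega
      _ ≤ 2 ^ ((d + 1) * 2 ^ d) * 2 := by
          rw [← pow_mul]
          have := Nat.one_le_two_pow (n := (d + 1) * 2 ^ d)
          omega
      _ = 2 ^ ((d + 1) * 2 ^ d + 1) := (pow_succ _ _).symm
      _ ≤ 2 ^ ((d + 2) * 2 ^ d) := Nat.pow_le_pow_right (by omega) (by linarith)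
  set M := (d + 2) ^ 2 ^ d + 1
  have hM1 : 1 ≤ M := by omega
  have hdM : d * M + 1 ≤ 2 ^ ((d + 3) * 2 ^ d) :=
    calc d * M + 1 ≤ (d + 1) * M := by linarith
      _ ≤ 2 ^ d * 2 ^ ((d + 2) * 2 ^ d) := Nat.mul_le_mul hd hM
      _ = 2 ^ (d + (d + 2) * 2 ^ d) := (pow_add _ _ _).symm
      _ ≤ 2 ^ ((d + 3) * 2 ^ d) := Nat.pow_le_pow_right (by omega) (by linarith)
  calc M * (d * M + 1) ^ d ≤ 2 ^ ((d + 2) * 2 ^ d) * (2 ^ ((d + 3) * 2 ^ d)) ^ d := by gcongr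
    _ = 2 ^ ((d + 2) * 2 ^ d + (d + 3) * 2 ^ d * d) := by rw [← pow_mul, ← pow_add]
    _ ≤ 2 ^ ((d + 3) ^ 2 * 2 ^ d) := Nat.pow_le_pow_right (by omega) (by nlinarith)

lemma loglog_le_ldim_boolLayers (n ℓ k : ℕ) (hℓ : 1 ≤ ℓ) (hℓk : ℓ < k) (hn : 2 * k ≤ n) :
    Real.logb 2 (Real.logb 2 n) ≤ ldim (BoolLayers n ℓ k) +
      2 * Real.logb 2 (ldim (BoolLayers n ℓ k) + 4) := by
  have hlt := lt_of_ldim_boolLayers n ℓ k hℓ hℓk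
  generalize ldim (BoolLayers n ℓ k) = d at hlt ⊢
  have hB := double_exp_bound d
  have hn2 : n < 2 ^ ((d + 4) ^ 2 * 2 ^ d) :=
    calc n < 2 ^ ((d + 3) ^ 2 * 2 ^ d) * 2 := by omega
      _ = 2 ^ ((d + 3) ^ 2 * 2 ^ d + 1) := (pow_succ _ _).symm
      _ ≤ 2 ^ ((d + 4) ^ 2 * 2 ^ d) := Nat.pow_le_pow_right (by omega) (by
          have := Nat.one_le_two_pow (n := d)
          calc (d + 3) ^ 2 * 2 ^ d + 1 ≤ ((d + 3) ^ 2 + 1) * 2 ^ d := by linarith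
            _ ≤ (d + 4) ^ 2 * 2 ^ d := Nat.mul_le_mul_right _ (by
              have : (d + 4) ^ 2 = (d + 3) ^ 2 + 1 + (2 * d + 6) := by ring
              omega))
  have hn4 : (2 : ℝ) ≤ n := by exact_mod_cast (show 2 ≤ n by omega)
  have hlog : 0 < Real.logb 2 n := Real.logb_pos (by norm_num) (by linarith)
  have h1 : Real.logb 2 n ≤ (d + 4) ^ 2 * 2 ^ d := by
    rw [Real.logb_le_iff_le_rpow (by norm_num) (by linarith)]
    have : (n : ℝ) ≤ 2 ^ ((d + 4) ^ 2 * 2 ^ d) := by exact_mod_cast hn2.le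
    rw [← Real.rpow_natCast] at this
    push_cast at this
    exact this
  calc Real.logb 2 (Real.logb 2 n) ≤ Real.logb 2 ((d + 4) ^ 2 * 2 ^ d) :=
        Real.logb_le_logb_of_le (by norm_num) hlog h1
    _ = d + 2 * Real.logb 2 (d + 4) := by
        rw [Real.logb_mul (by positivity) (by positivity), Real.logb_pow, Real.logb_pow,
          Real.logb_self_eq_one (by norm_num)]
        push_cast
        ring

lemma eventually_logb_add_le (ε : ℝ) (hε : 0 < ε) :
    ∀ᶠ t : ℝ in Filter.atTop, 2 * Real.logb 2 (t + 4) ≤ ε * t := by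
  have h2 : 0 < Real.log 2 := Real.log_pos (by norm_num)
  have hc : 0 < ε * Real.log 2 / 4 := by positivity
  have h := (Real.isLittleO_log_id_atTop.def hc)
  have hshift : Filter.Tendsto (fun t : ℝ => t + 4) Filter.atTop Filter.atTop :=
    Filter.tendsto_atTop_add_const_right _ _ Filter.tendsto_id
  filter_upwards [hshift.eventually h, Filter.eventually_ge_atTop 4] with t ht ht4
  simp only [id, Real.norm_eq_abs] at ht
  rw [abs_of_nonneg (show 0 ≤ t + 4 by linarith)] at ht
  have hle : Real.log (t + 4) ≤ ε * t / 2 * Real.log 2 := by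
    refine (le_abs_self _).trans (ht.trans ?_)
    calc ε * Real.log 2 / 4 * (t + 4) ≤ ε * Real.log 2 / 4 * (2 * t) := by
          gcongr
          linarith
      _ = ε * t / 2 * Real.log 2 := by ring
  have := (div_le_iff₀ h2).2 hle
  rw [Real.logb]
  linarith

end PaperLD

open PaperLD

/-- For all fixed `1 ≤ ℓ < k` and every `ε > 0` there is `n₀` such that for all `n ≥ n₀`,
`ldim(Q(n; ℓ, k)) ≥ (1 − ε)·log log n` (logs base 2). -/
theorem stmt10 (ℓ k : ℕ) (hℓ : 1 ≤ ℓ) (hℓk : ℓ < k) (ε : ℝ) (hε : 0 < ε) :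
    ∃ n₀ : ℕ, ∀ n : ℕ, n₀ ≤ n →
      (1 - ε) * Real.logb 2 (Real.logb 2 n) ≤ (ldim (BoolLayers n ℓ k) : ℝ) := by
  have hlog : Filter.Tendsto (Real.logb 2) Filter.atTop Filter.atTop :=
    Real.tendsto_logb_atTop (by norm_num)
  have ht : Filter.Tendsto (fun n : ℕ => Real.logb 2 (Real.logb 2 n)) Filter.atTop Filter.atTop :=
    hlog.comp (hlog.comp tendsto_natCast_atTop_atTop)
  refine Filter.eventually_atTop.1 ?_
  filter_upwards [ht.eventually (eventually_logb_add_le ε hε),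
    ht.eventually (Filter.eventually_ge_atTop 0), Filter.eventually_ge_atTop (2 * k)]
    with n hε' ht0 hn
  by_contra! hlt
  have hub := loglog_le_ldim_boolLayers n ℓ k hℓ hℓk hn
  set t := Real.logb 2 (Real.logb 2 n)
  have hεt : 0 ≤ ε * t := by positivity
  have hmono : Real.logb 2 (ldim (BoolLayers n ℓ k) + 4) ≤ Real.logb 2 (t + 4) :=
    Real.logb_le_logb_of_le (by norm_num) (by positivity) (by linarith)
  linarith
end

section
/- For all integers 1 ≤ k ≤ n − 1 there is an order embedding of Q(n − k + 1; 1, 2) into Q(n; k, k + 1); and for all integers 0 ≤ ℓ < k ≤ n there is an order embedding of Q(n; ℓ, k) into Q(n + 1; ℓ, k + 1). -/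
open scoped Classical

open PaperLD

/-- Adjoining `j` new points and enlarging every `s` by a set of new points that depends
monotonically on the cardinality of `s` embeds layers of a Boolean lattice in a larger one. -/
theorem PaperLD.BoolLayers.nonempty_orderEmbedding_of_monotone {m j : ℕ} (a b : ℕ)
    {φ : ℕ → Finset (Fin j)} (hφ : Monotone φ) :
    Nonempty (BoolLayers m a b ↪o BoolLayers (m + j) (a + (φ a).card) (b + (φ b).card)) := by
  refine ⟨OrderEmbedding.ofMapLEIff (fun s =>
    ⟨(s.1.disjSum (φ s.1.card)).map finSumFinEquiv.toEmbedding, ?_⟩) fun s t => ?_⟩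
  · rw [Finset.card_map, Finset.card_disjSum]
    exact s.2.imp (fun h => by rw [h]) fun h => by rw [h]
  · rw [Subtype.mk_le_mk, Finset.map_subset_map]
    refine ⟨fun h x hx => ?_, fun h => Finset.disjSum_mono h (hφ (Finset.card_le_card h))⟩
    exact Finset.inl_mem_disjSum.mp (h (Finset.inl_mem_disjSum.mpr hx))

/-- For `1 ≤ k ≤ n − 1` there is an order embedding of `Q(n − k + 1; 1, 2)` into
`Q(n; k, k + 1)`; and for `0 ≤ ℓ < k ≤ n` there is an order embedding of `Q(n; ℓ, k)`
into `Q(n + 1; ℓ, k + 1)`. -/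
theorem stmt11 :
    (∀ n k : ℕ, 1 ≤ k → k ≤ n - 1 →
      Nonempty (BoolLayers (n - k + 1) 1 2 ↪o BoolLayers n k (k + 1))) ∧
    (∀ n ℓ k : ℕ, ℓ < k → k ≤ n →
      Nonempty (BoolLayers n ℓ k ↪o BoolLayers (n + 1) ℓ (k + 1))) := by
  refine ⟨fun n k h₁ h₂ => ?_, fun n ℓ k h _ => ?_⟩
  · have key := BoolLayers.nonempty_orderEmbedding_of_monotone (m := n - k + 1) 1 2
      (monotone_const (c := (Finset.univ : Finset (Fin (k - 1)))))
    rw [Finset.card_univ, Fintype.card_fin] at key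
    rwa [show n - k + 1 + (k - 1) = n by lia, show 1 + (k - 1) = k by lia,
      show 2 + (k - 1) = k + 1 by lia] at key
  · have hφ : Monotone fun c : ℕ => (Finset.univ.filter fun _ => ℓ < c : Finset (Fin 1)) :=
      fun c d hcd => Finset.monotone_filter_right _ fun _ _ hc => lt_of_lt_of_le hc hcd
    have key := BoolLayers.nonempty_orderEmbedding_of_monotone (m := n) ℓ k hφ
    rwa [Finset.filter_false_of_mem fun _ _ => lt_irrefl ℓ, Finset.filter_true_of_mem fun _ _ => h,
      Finset.card_empty, Finset.card_univ, Fintype.card_fin, add_zero] at key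
end

section
/- For every positive integer n, there exists a finite poset P with dim(P) = n and ldim(P) = n. -/
open scoped Classical

open PaperLD

namespace PaperLD

section

variable {α : Type*} [PartialOrder α]

theorem mult_le {N : ℕ} (F : Fin N → PLE α) (x : α) : mult F x ≤ N :=
  (Finset.card_filter_le _ _).trans (Finset.card_fin N).le

theorem PLE.before_iff (L : PLE α) (x y : α) :
    L.Before x y ↔ x ∈ L.toList ∧ y ∈ L.toList ∧ L.toList.idxOf x ≤ L.toList.idxOf y := by
  constructor
  · rintro ⟨i, j, hij, rfl, rfl⟩
    refine ⟨List.get_mem _ _, List.get_mem _ _, ?_⟩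
    simpa [List.get_eq_getElem, L.nodup.idxOf_getElem] using hij
  · rintro ⟨hx, hy, h⟩
    exact ⟨⟨_, List.idxOf_lt_length_iff.2 hx⟩, ⟨_, List.idxOf_lt_length_iff.2 hy⟩, h,
      by simp, by simp⟩

theorem PLE.idxOf_le_of_le (L : PLE α) {x y : α} (hx : x ∈ L.toList) (hy : y ∈ L.toList)
    (h : x ≤ y) : L.toList.idxOf x ≤ L.toList.idxOf y :=
  L.le_imp ⟨_, List.idxOf_lt_length_iff.2 hx⟩ ⟨_, List.idxOf_lt_length_iff.2 hy⟩ (by simpa using h)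

/-- Two elements separated by a set `R` of upper bounds are separated by the positions of the
elements of `R` immediately preceding them in a local realiser; counting the possible positions
bounds the size of the poset. -/
theorem IsLocalRealiser.card_le [Fintype α] {N d : ℕ} {F : Fin N → PLE α}
    (hF : IsLocalRealiser F) (hd : ∀ x, mult F x ≤ d) (R : Finset α)
    (hR : ∀ x y : α, (∀ r ∈ R, x ≤ r ↔ y ≤ r) → x = y) :
    Fintype.card α ≤ (d * R.card + 1) ^ d := by
  let pos (i : Fin N) (x : α) : ℕ := (F i).toList.idxOf x
  let S : Finset (Fin N × α) := Finset.univ.filter fun p => p.2 ∈ R ∧ p.2 ∈ (F p.1).toList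
  let T (x : α) : Finset S := Finset.univ.filter fun p =>
    x ∈ (F p.1.1).toList ∧ pos p.1.1 p.1.2 < pos p.1.1 x ∧
      ∀ r ∈ R, r ∈ (F p.1.1).toList → pos p.1.1 r < pos p.1.1 x → pos p.1.1 r ≤ pos p.1.1 p.1.2
  have hS : S.card ≤ d * R.card := by
    refine Finset.card_le_mul_card_image_of_maps_to (f := Prod.snd) (fun p hp => ?_) d fun r _ => ?_
    · exact (Finset.mem_filter.1 hp).2.1
    · refine le_trans (Finset.card_le_card_of_injOn Prod.fst ?_ ?_) (hd r)
      · intro p hp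
        simp only [S, Finset.coe_filter, Finset.mem_filter, Set.mem_ofPred_eq] at hp ⊢
        exact ⟨Finset.mem_univ _, hp.2 ▸ hp.1.2.2⟩
      · intro p hp q hq h
        simp only [Finset.coe_filter, Set.mem_ofPred_eq] at hp hq
        exact Prod.ext h (hp.2.trans hq.2.symm)
  have hT (x : α) : (T x).card ≤ d := by
    refine le_trans (Finset.card_le_card_of_injOn (fun p => p.1.1) ?_ ?_) (hd x)
    · intro p hp
      simp only [T, Finset.coe_filter, Set.mem_ofPred_eq] at hp ⊢
      exact ⟨Finset.mem_univ _, hp.2.1⟩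
    · rintro ⟨⟨i, r⟩, hr⟩ hp ⟨⟨j, s⟩, hs⟩ hq h
      obtain rfl : i = j := h
      simp only [T, Finset.coe_filter, Set.mem_ofPred_eq] at hp hq
      have hr' := (Finset.mem_filter.1 hr).2
      have hs' := (Finset.mem_filter.1 hs).2
      have : pos i r = pos i s :=
        le_antisymm (hq.2.2.2 r hr'.1 hr'.2 hp.2.2.1) (hp.2.2.2 s hs'.1 hs'.2 hq.2.2.1)
      obtain rfl := (List.idxOf_inj hr'.2).1 this
      rfl
  have key (x y : α) (hxy : T x = T y) (r : α) (hr : r ∈ R) (hy : y ≤ r) : x ≤ r := by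
    by_contra hx
    obtain ⟨i, hi⟩ := hF r x hx
    obtain ⟨hri, hxi, hle⟩ := ((F i).before_iff r x).1 hi
    have hlt : pos i r < pos i x := lt_of_le_of_ne hle fun h =>
      hx ((List.idxOf_inj hri).1 h).ge
    obtain ⟨s, hs, hmax⟩ := Finset.exists_max_image
      (R.filter fun r => r ∈ (F i).toList ∧ pos i r < pos i x) (pos i)
      ⟨r, Finset.mem_filter.2 ⟨hr, hri, hlt⟩⟩
    obtain ⟨hsR, hsi, hsx⟩ := Finset.mem_filter.1 hs
    have hsS : (i, s) ∈ S := Finset.mem_filter.2 ⟨Finset.mem_univ _, hsR, hsi⟩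
    have hsT : (⟨(i, s), hsS⟩ : S) ∈ T x := Finset.mem_filter.2 ⟨Finset.mem_univ _, hxi, hsx,
      fun t ht hti htx => hmax t (Finset.mem_filter.2 ⟨ht, hti, htx⟩)⟩
    rw [hxy] at hsT
    obtain ⟨-, hyi, hsy, -⟩ := Finset.mem_filter.1 hsT
    have h₁ : pos i r ≤ pos i s := hmax r (Finset.mem_filter.2 ⟨hr, hri, hlt⟩)
    exact absurd ((F i).idxOf_le_of_le hyi hri hy) (not_le.2 (h₁.trans_lt hsy))
  have inj : Function.Injective fun (x : α) (j : Fin d) => (T x).toList[j.1]? := by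
    intro x y h
    have hl : (T x).toList = (T y).toList := by
      refine List.ext_getElem? fun m => ?_
      by_cases hm : m < d
      · exact congrFun h ⟨m, hm⟩
      · rw [List.getElem?_eq_none (by have := hT x; simp; omega),
          List.getElem?_eq_none (by have := hT y; simp; omega)]
    have hxy : T x = T y := by rw [← Finset.toList_toFinset (T x), hl, Finset.toList_toFinset]
    exact hR x y fun r hr => ⟨key y x hxy.symm r hr, key x y hxy r hr⟩
  calc Fintype.card α ≤ Fintype.card (Fin d → Option S) := Fintype.card_le_of_injective _ inj
    _ = (S.card + 1) ^ d := by simp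
    _ ≤ _ := Nat.pow_le_pow_left (by omega) d

/-- A monotone injection into a linear order induces a linear extension. -/
theorem exists_PLE_of_monotone [Fintype α] {β : Type*} [LinearOrder β] (φ : α → β)
    (hφ : Monotone φ) (hinj : Function.Injective φ) :
    ∃ L : PLE α, (∀ x, x ∈ L.toList) ∧ ∀ x y, φ x ≤ φ y → L.Before x y := by
  let r : α → α → Prop := fun a b => φ a ≤ φ b
  have : IsTrans α r := ⟨fun _ _ _ => le_trans⟩
  have : Std.Antisymm r := ⟨fun _ _ h h' => hinj (le_antisymm h h')⟩
  have : Std.Total r := ⟨fun a b => le_total (φ a) (φ b)⟩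
  let l : List α := Finset.univ.sort r
  have hmem (x : α) : x ∈ l := by simp [l]
  have hnd : l.Nodup := Finset.sort_nodup _ _
  have hl (i j : Fin l.length) (h : φ (l.get i) ≤ φ (l.get j)) : i ≤ j := by
    by_contra! hji
    have := List.pairwise_iff_get.1 (Finset.pairwise_sort Finset.univ r) j i hji
    exact hji.ne (hnd.injective_get (hinj (le_antisymm this h)))
  let L : PLE α := ⟨l, hnd, fun i j h => hl i j (hφ h)⟩
  refine ⟨L, hmem, fun x y h => ?_⟩
  obtain ⟨i, rfl⟩ := List.get_of_mem (hmem x)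
  obtain ⟨j, rfl⟩ := List.get_of_mem (hmem y)
  exact ⟨i, j, hl i j h, rfl, rfl⟩

end

/-- A power of a chain with `n` factors has a realiser consisting of `n` linear extensions. -/
theorem exists_realiser_pi (n k : ℕ) :
    ∃ F : Fin n → PLE (Fin n → Fin k), (∀ i, ∀ x, x ∈ (F i).toList) ∧ IsLocalRealiser F := by
  have (i : Fin n) := exists_PLE_of_monotone
    (fun x : Fin n → Fin k => toLex (x i, toLex x))
    (fun x y h => Prod.Lex.toLex_mono (Prod.mk_le_mk.2 ⟨h i, Pi.toLex_monotone h⟩))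
    (fun x y h => toLex.injective (Prod.ext_iff.1 (toLex.injective h)).2)
  choose F hF hle using this
  refine ⟨F, hF, fun x y h => ?_⟩
  rw [Pi.le_def] at h
  push Not at h
  obtain ⟨i, hi⟩ := h
  exact ⟨i, hle i x y (Prod.Lex.toLex_le_toLex.2 (Or.inl hi))⟩

/-- Counting bound relating the size of a grid with `n` factors to the multiplicity of a local
realiser. -/
theorem pow_le_of_isLocalRealiser_pi {n k N d : ℕ} {F : Fin N → PLE (Fin n → Fin (k + 1))}
    (hF : IsLocalRealiser F) (hd : ∀ x, mult F x ≤ d) :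
    (k + 1) ^ n ≤ (d * (n * (k + 1)) + 1) ^ d := by
  let ruler (p : Fin n × Fin (k + 1)) : Fin n → Fin (k + 1) := Function.update ⊤ p.1 p.2
  have hruler (x : Fin n → Fin (k + 1)) (i t) : x ≤ ruler (i, t) ↔ x i ≤ t := by
    simp [ruler, le_update_iff, le_top]
  have h := hF.card_le hd (Finset.univ.image ruler) fun x y h => by
    have h' (i t) : x i ≤ t ↔ y i ≤ t := by
      simpa only [hruler] using h (ruler (i, t)) (Finset.mem_image_of_mem _ (Finset.mem_univ _))
    exact funext fun i => le_antisymm ((h' i _).2 le_rfl) ((h' i _).1 le_rfl)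
  have hc : (Finset.univ.image ruler).card ≤ n * (k + 1) :=
    Finset.card_image_le.trans (by simp)
  calc (k + 1) ^ n = Fintype.card (Fin n → Fin (k + 1)) := by simp
    _ ≤ _ := h
    _ ≤ _ := by gcongr

theorem le_of_isLocalRealiser_pi {n N d : ℕ}
    {F : Fin N → PLE (Fin n → Fin ((n * n + 1) ^ n + 1))}
    (hF : IsLocalRealiser F) (hd : ∀ x, mult F x ≤ d) : n ≤ d := by
  by_contra! hdn
  have h := pow_le_of_isLocalRealiser_pi hF hd
  set K := (n * n + 1) ^ n + 1 with hK
  have hKpos : 0 < K := Nat.succ_pos _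
  have : (d * (n * K) + 1) ^ d < K ^ n :=
    calc (d * (n * K) + 1) ^ d ≤ ((n * n + 1) * K) ^ d := by
          gcongr
          nlinarith [Nat.mul_le_mul_right (n * K) hdn.le]
      _ = (n * n + 1) ^ d * K ^ d := mul_pow _ _ _
      _ ≤ (n * n + 1) ^ n * K ^ d := by gcongr; omega
      _ < K * K ^ d := by gcongr; omega
      _ = K ^ (d + 1) := by ring
      _ ≤ K ^ n := Nat.pow_le_pow_right hKpos hdn
  omega

end PaperLD

/-- For every positive integer `n` there is a finite (nonempty) poset whose order
dimension and local dimension both equal `n`. -/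
theorem stmt12 (n : ℕ) (hn : 1 ≤ n) :
    ∃ (α : Type) (instPO : PartialOrder α) (instFT : Fintype α) (_ : Nonempty α),
      @odim α instPO instFT = n ∧ @ldim α instPO instFT = n := by
  have hreal := exists_realiser_pi n ((n * n + 1) ^ n + 1)
  refine ⟨Fin n → Fin ((n * n + 1) ^ n + 1), inferInstance, inferInstance, inferInstance, ?_, ?_⟩
  · refine le_antisymm (Nat.sInf_le hreal) (le_csInf ⟨n, hreal⟩ ?_)
    rintro d ⟨F, -, hF⟩
    exact le_of_isLocalRealiser_pi hF (mult_le F)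
  · obtain ⟨F, -, hF⟩ := hreal
    have hmem : n ∈ {d | ∃ (N : ℕ) (F : Fin N → PLE (Fin n → Fin ((n * n + 1) ^ n + 1))),
        IsLocalRealiser F ∧ ∀ x, mult F x ≤ d} := ⟨n, F, hF, mult_le F⟩
    refine le_antisymm (Nat.sInf_le hmem) (le_csInf ⟨n, hmem⟩ ?_)
    rintro d ⟨N, F, hF, hd⟩
    exact le_of_isLocalRealiser_pi hF hd
end

section
/- For all integers n ≥ 1, ℓ ≥ 1, and k ≥ 0 with ℓ < n − k, ldim(Q(n; ℓ, n − k)) ≤ 2 + max{ℓ, k}. -/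
open scoped Classical

namespace PaperLD

section General

variable {α : Type*} [PartialOrder α]

/-- A list in which no element is above or equal to a later one is a partial linear extension. -/
def PLE.ofPairwise (l : List α) (hl : l.Pairwise fun x y => ¬ y ≤ x) : PLE α where
  toList := l
  nodup := hl.imp fun hxy heq => hxy heq.ge
  le_imp i j hij := by
    by_contra hlt
    exact List.pairwise_iff_get.1 hl j i (not_le.1 hlt) hij

theorem PLE.before_of_sublist {L : PLE α} {x y : α} (h : List.Sublist [x, y] L.toList) :
    L.Before x y := by
  obtain ⟨f, hf⟩ := List.sublist_iff_exists_fin_orderEmbedding_get_eq.1 h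
  exact ⟨f ⟨0, by simp⟩, f ⟨1, by simp⟩, f.monotone (by simp), (hf _).symm, (hf _).symm⟩

theorem mult_cons_le {N : ℕ} (L : PLE α) (F : Fin N → PLE α) (x : α) :
    mult (Fin.cons L F : Fin (N + 1) → PLE α) x ≤ mult F x + 1 := by
  unfold mult
  rw [Finset.card_filter, Finset.card_filter, Fin.sum_univ_succ, add_comm]
  refine add_le_add (by simp) ?_
  split_ifs <;> simp

end General

theorem pair_sublist_append {α : Type*} {l₁ l₂ : List α} {x y : α} (hx : x ∈ l₁) (hy : y ∈ l₂) :
    List.Sublist [x, y] (l₁ ++ l₂) :=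
  (List.singleton_sublist.2 hx).append (List.singleton_sublist.2 hy)

theorem pair_sublist_or_reverse {α : Type*} {l : List α} {x y : α} (hx : x ∈ l) (hy : y ∈ l)
    (hxy : x ≠ y) : List.Sublist [x, y] l ∨ List.Sublist [x, y] l.reverse := by
  obtain ⟨s, t, rfl⟩ := List.append_of_mem hx
  rcases List.mem_append.1 hy with hy | hy
  · right
    simpa using (pair_sublist_append hy (List.mem_singleton_self x)).reverse.trans
      (List.Sublist.reverse (by simp : List.Sublist (s ++ [x]) (s ++ x :: t)))
  · left
    have hyt : y ∈ t := by simpa [hxy.symm] using hy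
    exact ((List.singleton_sublist.2 hyt).cons_cons x).trans (List.sublist_append_right s _)

section Layers

variable (n ℓ m : ℕ)

/-- The members of `BoolLayers n ℓ m` of cardinality `r`, listed in some order. -/
noncomputable def layerList (r : ℕ) : List (BoolLayers n ℓ m) :=
  (Finset.univ.filter fun s : BoolLayers n ℓ m => s.1.card = r).toList

variable {n ℓ m}

@[simp] theorem mem_layerList {r : ℕ} {s : BoolLayers n ℓ m} :
    s ∈ layerList n ℓ m r ↔ s.1.card = r := by
  simp [layerList]

theorem pairwise_of_layer {r : ℕ} {l : List (BoolLayers n ℓ m)} (hl : l.Nodup)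
    (hr : ∀ s ∈ l, s.1.card = r) : l.Pairwise fun x y => ¬ y ≤ x :=
  List.Pairwise.imp_of_mem (fun {x y} hx hy hne hle =>
    hne (Subtype.ext (Finset.eq_of_subset_of_card_le hle (by rw [hr x hx, hr y hy])).symm)) hl

theorem pairwise_append_layers {r t : ℕ} {l₁ l₂ : List (BoolLayers n ℓ m)}
    (h₁ : l₁.Nodup) (h₂ : l₂.Nodup) (hr : ∀ s ∈ l₁, s.1.card = r) (ht : ∀ s ∈ l₂, s.1.card = t)
    (h : ∀ x ∈ l₁, ∀ y ∈ l₂, ¬ y ≤ x) : (l₁ ++ l₂).Pairwise fun x y => ¬ y ≤ x :=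
  List.pairwise_append.2 ⟨pairwise_of_layer h₁ hr, pairwise_of_layer h₂ ht, h⟩

theorem nodup_layerList (r : ℕ) : (layerList n ℓ m r).Nodup := Finset.nodup_toList _

theorem not_le_of_card_lt (h : ℓ < m) {x y : BoolLayers n ℓ m} (hx : x.1.card = ℓ)
    (hy : y.1.card = m) : ¬ y ≤ x := fun hle => by
  have := Finset.card_le_card (show y.1 ⊆ x.1 from hle)
  omega

/-- The lower layer followed by the upper layer. -/
noncomputable def lowerUpper (h : ℓ < m) : PLE (BoolLayers n ℓ m) :=
  .ofPairwise (layerList n ℓ m ℓ ++ layerList n ℓ m m) <|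
    pairwise_append_layers (r := ℓ) (t := m) (nodup_layerList _) (nodup_layerList _)
      (by simp) (by simp)
      fun x hx y hy => not_le_of_card_lt h (mem_layerList.1 hx) (mem_layerList.1 hy)

/-- The lower layer followed by the upper layer, each in the order opposite to `lowerUpper`. -/
noncomputable def lowerUpperReverse (h : ℓ < m) : PLE (BoolLayers n ℓ m) :=
  .ofPairwise ((layerList n ℓ m ℓ).reverse ++ (layerList n ℓ m m).reverse) <|
    pairwise_append_layers (r := ℓ) (t := m) (List.nodup_reverse.2 (nodup_layerList _))
      (List.nodup_reverse.2 (nodup_layerList _)) (by simp) (by simp)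
      fun x hx y hy => not_le_of_card_lt h (by simpa using hx) (by simpa using hy)

/-- The upper sets avoiding `i` followed by the lower sets containing `i`. -/
noncomputable def upperLower (i : Fin n) : PLE (BoolLayers n ℓ m) :=
  .ofPairwise ((layerList n ℓ m m).filter (fun s => i ∉ s.1) ++
      (layerList n ℓ m ℓ).filter (fun s => i ∈ s.1)) <|
    pairwise_append_layers (r := m) (t := ℓ) ((nodup_layerList _).filter _)
      ((nodup_layerList _).filter _) (by simp +contextual) (by simp +contextual)
      fun x hx y hy hle => by
        simp only [List.mem_filter, decide_eq_true_eq] at hx hy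
        exact hx.2 (hle hy.2)

/-- The two layer-by-layer orders together with all the orders `upperLower i`. -/
noncomputable def layersRealiser (h : ℓ < m) : Fin (n + 2) → PLE (BoolLayers n ℓ m) :=
  Fin.cons (lowerUpper h) (Fin.cons (lowerUpperReverse h) upperLower)

theorem isLocalRealiser_layersRealiser (h : ℓ < m) :
    IsLocalRealiser (layersRealiser (n := n) h) := by
  intro x y hyx
  have hxy : x ≠ y := fun heq => hyx heq.ge
  have same {r : ℕ} (hx : x ∈ layerList n ℓ m r) (hy : y ∈ layerList n ℓ m r)
      (hr : r = ℓ ∨ r = m) : ∃ i, (layersRealiser h i).Before x y := by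
    rcases pair_sublist_or_reverse hx hy hxy with hs | hs
    · refine ⟨0, PLE.before_of_sublist (L := lowerUpper h) (hs.trans ?_)⟩
      rcases hr with rfl | rfl
      · exact List.sublist_append_left _ _
      · exact List.sublist_append_right _ _
    · refine ⟨1, PLE.before_of_sublist (L := lowerUpperReverse h) (hs.trans ?_)⟩
      rcases hr with rfl | rfl
      · exact List.sublist_append_left _ _
      · exact List.sublist_append_right _ _
  rcases x.2 with hx | hx <;> rcases y.2 with hy | hy
  · exact same (mem_layerList.2 hx) (mem_layerList.2 hy) (.inl rfl)
  · exact ⟨0, PLE.before_of_sublist (L := lowerUpper h)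
      (pair_sublist_append (mem_layerList.2 hx) (mem_layerList.2 hy))⟩
  · obtain ⟨i, hiy, hix⟩ := Finset.not_subset.1 (show ¬ y.1 ⊆ x.1 from hyx)
    exact ⟨i.succ.succ, PLE.before_of_sublist (L := upperLower i)
      (pair_sublist_append (by simp [hx, hix]) (by simp [hy, hiy]))⟩
  · exact same (mem_layerList.2 hx) (mem_layerList.2 hy) (.inr rfl)

theorem mem_upperLower {i : Fin n} {x : BoolLayers n ℓ m} :
    x ∈ (upperLower i : PLE (BoolLayers n ℓ m)).toList ↔
      (x.1.card = ℓ ∧ i ∈ x.1) ∨ (x.1.card = m ∧ i ∉ x.1) := by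
  simp [upperLower, PLE.ofPairwise, or_comm]

theorem mult_layersRealiser_le (h : ℓ < m) (x : BoolLayers n ℓ m) :
    mult (layersRealiser h) x ≤ 2 + max ℓ (n - m) := by
  have hG : mult upperLower x ≤ max ℓ (n - m) := by
    unfold mult
    rcases x.2 with hx | hx
    · have : ∀ i, x ∈ (upperLower i : PLE (BoolLayers n ℓ m)).toList ↔ i ∈ x.1 := fun i => by
        rw [mem_upperLower]; simp [hx, h.ne]
      simp [this, hx]
    · have : ∀ i, x ∈ (upperLower i : PLE (BoolLayers n ℓ m)).toList ↔ i ∈ x.1ᶜ := fun i => by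
        rw [mem_upperLower]; simp [hx, h.ne']
      simp only [this, Finset.filter_univ_mem, Finset.card_compl, hx, Fintype.card_fin]
      exact le_max_right _ _
  have h₁ := mult_cons_le (lowerUpper h) (Fin.cons (lowerUpperReverse h) upperLower) x
  have h₂ := mult_cons_le (lowerUpperReverse h) upperLower x
  unfold layersRealiser
  omega

end Layers

end PaperLD

open PaperLD

/-- For `n ≥ 1`, `ℓ ≥ 1`, `k ≥ 0` with `ℓ < n − k`,
`ldim(Q(n; ℓ, n − k)) ≤ 2 + max{ℓ, k}`. -/
theorem stmt14 (n ℓ k : ℕ) (hn : 1 ≤ n) (hℓ : 1 ≤ ℓ) (h : ℓ < n - k) :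
    ldim (BoolLayers n ℓ (n - k)) ≤ 2 + max ℓ k := by
  refine Nat.sInf_le ⟨n + 2, layersRealiser h, isLocalRealiser_layersRealiser h, fun x => ?_⟩
  simpa [Nat.sub_sub_self (show k ≤ n by omega)] using mult_layersRealiser_le h x
end

section
/- For all integers n ≥ 2 and 2 ≤ k ≤ n, ldim(Q(n; 1, k)) ≤ n / log n + 2n · log log n / (log n)² + 3. -/
open scoped Classical

open PaperLD

namespace PaperLD

/-- A strictly monotone rank function on a finite set `Y` is refined by a partial linear
extension with ground set `Y`. -/
theorem exists_ple_of_rank {α : Type*} [PartialOrder α] [Fintype α] (Y : Finset α) (g : α → ℕ)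
    (hg : ∀ x ∈ Y, ∀ y ∈ Y, x < y → g x < g y) :
    ∃ L : PLE α, (∀ x, x ∈ L.toList ↔ x ∈ Y) ∧
      ∀ x ∈ Y, ∀ y ∈ Y, g x < g y → L.Before x y := by
  let e := Fintype.equivFin α
  let r : α → α → Prop := fun x y => toLex (g x, e x) ≤ toLex (g y, e y)
  have : IsTrans α r := ⟨fun _ _ _ h₁ h₂ => le_trans h₁ h₂⟩
  have : Std.Total r := ⟨fun _ _ => le_total _ _⟩
  have : Std.Antisymm r := ⟨fun x y h₁ h₂ => by
    have h := toLex.injective (le_antisymm h₁ h₂)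
    exact e.injective (Prod.ext_iff.mp h).2⟩
  have hs : (Y.sort r).Pairwise r := Finset.pairwise_sort Y r
  have hnd : (Y.sort r).Nodup := Finset.sort_nodup Y r
  have hmem : ∀ x, x ∈ Y.sort r ↔ x ∈ Y := fun x => Finset.mem_sort r
  refine ⟨⟨Y.sort r, hnd, ?_⟩, hmem, ?_⟩
  · intro i j hij
    by_contra! hlt
    have hne : (Y.sort r).get i ≠ (Y.sort r).get j := fun h =>
      hlt.ne' (hnd.injective_get h)
    have h₁ := hg _ ((hmem _).1 (List.get_mem _ i)) _ ((hmem _).1 (List.get_mem _ j))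
      (lt_of_le_of_ne hij hne)
    have h₂ : r _ _ := List.pairwise_iff_get.1 hs j i hlt
    have h₃ := (Prod.Lex.toLex_le_toLex.1 h₂)
    simp only at h₃
    omega
  · intro x hx y hy hxy
    obtain ⟨i, hi⟩ := List.get_of_mem ((hmem x).2 hx)
    obtain ⟨j, hj⟩ := List.get_of_mem ((hmem y).2 hy)
    refine ⟨i, j, ?_, hi, hj⟩
    by_contra! hlt
    have h₂ : r _ _ := List.pairwise_iff_get.1 hs j i hlt
    rw [hi, hj] at h₂
    have h₃ := (Prod.Lex.toLex_le_toLex.1 h₂)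
    simp only at h₃
    omega

/-- A local realiser indexed by any finite type bounds the local dimension. -/
theorem ldim_le_of_isLocalRealiser {α ι : Type*} [PartialOrder α] [Fintype α] [Fintype ι]
    (F : ι → PLE α) (hF : IsLocalRealiser F) (d : ℕ)
    (hd : ∀ x, ∃ S : Finset ι, (∀ i, x ∈ (F i).toList → i ∈ S) ∧ S.card ≤ d) : ldim α ≤ d := by
  let e := Fintype.equivFin ι
  refine Nat.sInf_le ⟨Fintype.card ι, F ∘ e.symm, ?_, ?_⟩
  · intro x y hxy
    obtain ⟨i, hi⟩ := hF x y hxy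
    exact ⟨e i, by simpa using hi⟩
  · intro x
    obtain ⟨S, hS, hcard⟩ := hd x
    refine le_trans ?_ hcard
    refine Finset.card_le_card_of_injOn e.symm ?_ e.symm.injective.injOn
    intro i hi
    exact hS _ (by simpa using hi)

/-- The `b`-th interval of length `s` in `Fin n`. -/
def block (n s b : ℕ) : Finset (Fin n) := Finset.univ.filter fun i => i.val / s = b

theorem mem_block {n s b : ℕ} {i : Fin n} : i ∈ block n s b ↔ i.val / s = b := by
  simp [block]

theorem card_block_le (n s b : ℕ) (hs : 1 ≤ s) : (block n s b).card ≤ s := by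
  calc (block n s b).card ≤ (Finset.range s).card := by
        refine Finset.card_le_card_of_injOn (fun i => i.val % s) ?_ ?_
        · intro i _
          simpa using Nat.mod_lt _ hs
        · intro i hi j hj hij
          have hi' := mem_block.1 hi
          have hj' := mem_block.1 hj
          have h₁ := Nat.div_add_mod i.val s
          have h₂ := Nat.div_add_mod j.val s
          simp only at hij
          rw [hi'] at h₁
          rw [hj'] at h₂
          exact Fin.ext (by omega)
    _ = s := Finset.card_range s

theorem card_eq_of_lt {n k : ℕ} (hk : 2 ≤ k) {x y : BoolLayers n 1 k} (h : x < y) :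
    x.1.card = 1 ∧ y.1.card = k := by
  have := Finset.card_lt_card (Subtype.coe_lt_coe.2 h)
  have hx := x.2
  have hy := y.2
  omega

/-- Cutting `Fin n` into intervals of length `s` and sorting the `k`-sets by their traces on each
interval. -/
theorem ldim_boolLayers_one_le (n k s : ℕ) (hk : 2 ≤ k) (hs : 1 ≤ s) :
    ldim (BoolLayers n 1 k) ≤ 2 + max (n / s + 1) (2 ^ s) := by
  let α := BoolLayers n 1 k
  let N := Fintype.card α
  let e : α ≃ Fin N := Fintype.equivFin α
  let level : α → ℕ := fun x => if x.1.card = 1 then 0 else 1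
  have hlevel : ∀ x y : α, x < y → level x = 0 ∧ level y = 1 := by
    intro x y h
    obtain ⟨hx, hy⟩ := card_eq_of_lt hk h
    refine ⟨by simp [level, hx], ?_⟩
    have : k ≠ 1 := by omega
    simp [level, hy, this]
  obtain ⟨L₁, hL₁, hB₁⟩ := exists_ple_of_rank (Finset.univ : Finset α)
    (fun x => level x * N + (e x).val) (by
      intro x _ y _ h
      obtain ⟨hx, hy⟩ := hlevel x y h
      have := (e x).isLt
      simp only [hx, hy]
      omega)
  obtain ⟨L₂, hL₂, hB₂⟩ := exists_ple_of_rank (Finset.univ : Finset α)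
    (fun x => level x * N + (N - 1 - (e x).val)) (by
      intro x _ y _ h
      obtain ⟨hx, hy⟩ := hlevel x y h
      have := (e x).isLt
      simp only [hx, hy]
      omega)
  let ground : Fin (n / s + 1) × Finset (Fin n) → Finset α := fun p =>
    Finset.univ.filter fun z => (z.1.card = k ∧ z.1 ∩ block n s p.1 = p.2) ∨
      (z.1.card = 1 ∧ z.1 ⊆ block n s p.1 ∧ p.2 ⊆ block n s p.1)
  let rank : Fin (n / s + 1) × Finset (Fin n) → α → ℕ := fun p z =>
    if z.1.card = k then 1 else if z.1 ⊆ p.2 then 0 else 2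
  have hex := fun p => exists_ple_of_rank (ground p) (rank p) (by
    intro x hx y hy h
    obtain ⟨hx1, hyk⟩ := card_eq_of_lt hk h
    have hne : (1 : ℕ) ≠ k := by omega
    simp only [ground, Finset.mem_filter, Finset.mem_univ, true_and, hx1, hyk, hne, hne.symm,
      false_and, or_false, false_or] at hx hy
    have hsub : x.1 ⊆ p.2 := hy ▸ Finset.subset_inter h.le hx.1
    simp [rank, hx1, hyk, hne, hsub])
  choose M hM hBM using hex
  refine ldim_le_of_isLocalRealiser (Sum.elim (fun b : Bool => if b then L₁ else L₂) M) ?_ _ ?_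
  · intro x y hxy
    have hne : x ≠ y := fun h => hxy h.ge
    have hexy : (e x).val ≠ (e y).val := fun h => hne (e.injective (Fin.ext h))
    have hex := (e x).isLt
    have hey := (e y).isLt
    by_cases hl : level x ≤ level y
    · have hmul : level x * N ≤ level y * N := Nat.mul_le_mul_right _ hl
      rcases lt_or_gt_of_ne hexy with h | h
      · exact ⟨Sum.inl true, by
          simpa using hB₁ x (Finset.mem_univ _) y (Finset.mem_univ _) (by omega)⟩
      · exact ⟨Sum.inl false, by
          simpa using hB₂ x (Finset.mem_univ _) y (Finset.mem_univ _) (by omega)⟩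
    · have hx1 : x.1.card ≠ 1 := by
        intro h
        simp [level, h] at hl
      have hxk : x.1.card = k := x.2.resolve_left hx1
      have hy1 : y.1.card = 1 := by
        by_contra h
        simp [level, h, hx1] at hl
      obtain ⟨a, ha⟩ := Finset.card_eq_one.1 hy1
      have hax : a ∉ x.1 := by
        intro h
        apply hxy
        change y.1 ⊆ x.1
        rw [ha]
        simpa using h
      have hne1 : (1 : ℕ) ≠ k := by omega
      let b : Fin (n / s + 1) := ⟨a.val / s, Nat.lt_succ_of_le (Nat.div_le_div_right a.isLt.le)⟩
      have hab : a ∈ block n s b := mem_block.2 rfl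
      refine ⟨Sum.inr (b, x.1 ∩ block n s b), hBM _ x ?_ y ?_ ?_⟩
      · simp [ground, hxk]
      · simp [ground, ha, hab]
      · have : ¬ y.1 ⊆ x.1 ∩ block n s b := by
          rw [ha]
          simp [hax]
        simp only [rank, hxk, hy1, hne1, this, if_true, if_false]
        omega
  · intro x
    refine ⟨(Finset.univ : Finset Bool).disjSum (Finset.univ.filter fun p => x ∈ ground p),
      ?_, ?_⟩
    · rintro (b | p) h
      · simp
      · simpa [hM] using h
    · rw [Finset.card_disjSum, Finset.card_univ, Fintype.card_bool]
      refine Nat.add_le_add_left ?_ 2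
      have hne1 : (1 : ℕ) ≠ k := by omega
      rcases x.2 with hx | hx
      · refine le_trans ?_ (le_max_right _ _)
        obtain ⟨a, ha⟩ := Finset.card_eq_one.1 hx
        calc _ ≤ (block n s (a.val / s)).powerset.card := by
              refine Finset.card_le_card_of_injOn Prod.snd ?_ ?_
              · rintro ⟨b, T⟩ h
                simp [ground, hne1, ha, mem_block] at h
                simpa [h.1] using h.2
              · rintro ⟨b, T⟩ h ⟨b', T'⟩ h' hT
                simp [ground, hne1, ha, mem_block] at h h'
                exact Prod.ext (Fin.ext (h.1.symm.trans h'.1)) hT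
          _ ≤ 2 ^ s := by
              rw [Finset.card_powerset]
              exact Nat.pow_le_pow_right (by norm_num) (card_block_le n s _ hs)
      · refine le_trans ?_ (le_max_left _ _)
        calc _ ≤ (Finset.univ : Finset (Fin (n / s + 1))).card := by
              refine Finset.card_le_card_of_injOn Prod.fst (fun _ _ => Finset.mem_univ _) ?_
              rintro ⟨b, T⟩ h ⟨b', T'⟩ h' hb
              simp [ground, hne1.symm, hx] at h h'
              simp only at hb
              subst hb
              exact Prod.ext rfl (h.symm.trans h')
          _ = n / s + 1 := by simp

open Real in
/-- The chord of `logb 2` between two points of its graph lies below the graph. -/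
theorem chord_le_logb_two {a b u v x : ℝ} (ha : 0 < a) (hab : a < b) (hu : logb 2 a = u)
    (hv : logb 2 b = v) (hax : a ≤ x) (hxb : x ≤ b) :
    u * (b - x) + v * (x - a) ≤ (b - a) * logb 2 x := by
  have hpos : 0 < b - a := sub_pos.2 hab
  have h := strictConcaveOn_log_Ioi.concaveOn.2 (Set.mem_Ioi.2 ha)
    (Set.mem_Ioi.2 (ha.trans hab)) (div_nonneg (sub_nonneg.2 hxb) hpos.le)
    (div_nonneg (sub_nonneg.2 hax) hpos.le) (by field_simp; ring)
  have hx : (b - x) / (b - a) * a + (x - a) / (b - a) * b = x := by field_simp; ring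
  simp only [smul_eq_mul] at h
  rw [hx] at h
  have hl2 : 0 < log 2 := log_pos (by norm_num)
  have hla : log a = u * log 2 := by rw [← hu, logb]; field_simp
  have hlb : log b = v * log 2 := by rw [← hv, logb]; field_simp
  have hlx : log x = logb 2 x * log 2 := by rw [logb]; field_simp
  rw [hla, hlb, hlx] at h
  have h' : (u * (b - x) + v * (x - a)) / (b - a) * log 2 ≤ logb 2 x * log 2 := by
    refine le_trans (le_of_eq ?_) h
    field_simp
  have h'' := le_of_mul_le_mul_right h' hl2
  rw [div_le_iff₀ hpos] at h''
  linarith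

open Real in
theorem logb_two_two_pow (m : ℕ) : logb 2 ((2 : ℝ) ^ m) = m := by
  rw [logb_pow, logb_self_eq_one (by norm_num), mul_one]

open Real in
theorem two_mul_logb_two_le {x : ℝ} (hx : 4 ≤ x) : 2 * logb 2 x ≤ x := by
  have h := chord_le_logb_two (a := 2) (b := x) (x := 4) (by norm_num) (by linarith)
    (logb_self_eq_one (by norm_num)) rfl (by norm_num) hx
  have h4 : logb 2 4 = 2 := by
    have := logb_two_two_pow 2
    norm_num at this
    exact this
  rw [h4] at h
  linarith

open Real in
/-- A block length balancing the number of blocks against the number of traces on a block. -/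
theorem exists_block_length (n : ℕ) (hn : 2 ≤ n) (R : ℝ)
    (hR : R = n * (logb 2 n + 2 * logb 2 (logb 2 n)) / (logb 2 n) ^ 2) :
    ∃ s : ℕ, 1 ≤ s ∧ (n : ℝ) / s ≤ R ∧ (2 : ℝ) ^ s ≤ R + 1 := by
  have hn' : (2 : ℝ) ≤ n := by exact_mod_cast hn
  have hn0 : (0 : ℝ) < n := by linarith
  have hmono : ∀ m : ℕ, (2 : ℝ) ^ m ≤ n → (m : ℝ) ≤ logb 2 n := fun m h => by
    rw [← logb_two_two_pow m]
    exact logb_le_logb_of_le (by norm_num) (by positivity) h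
  have hmono' : ∀ m : ℕ, (n : ℝ) ≤ 2 ^ m → logb 2 n ≤ (m : ℝ) := fun m h => by
    rw [← logb_two_two_pow m]
    exact logb_le_logb_of_le (by norm_num) hn0 h
  have hpow : (2 : ℝ) ^ logb 2 n = n := rpow_logb (by norm_num) (by norm_num) hn0
  have h1 : (1 : ℝ) ≤ logb 2 n := by simpa using hmono 1 (by simpa using hn')
  have hl1 : logb 2 2 = 1 := logb_self_eq_one (by norm_num)
  have hl4 : logb 2 4 = 2 := by
    have := logb_two_two_pow 2
    norm_num at this
    exact this
  set L := logb 2 n with hL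
  set l := logb 2 L with hl
  have hL0 : 0 < L := by linarith
  have hL2 : 0 < L ^ 2 := by positivity
  rcases lt_or_ge n 4 with h4 | h4
  · have h4' : (n : ℝ) ≤ 2 ^ 2 := by norm_num; exact_mod_cast h4.le
    have hLle : L ≤ 2 := by simpa using hmono' 2 h4'
    have hch := chord_le_logb_two (a := 1) (b := 2) (x := L) (by norm_num) (by norm_num)
      logb_one hl1 h1 hLle
    rw [← hl] at hch
    have hnR : (n : ℝ) ≤ R := by
      rw [hR, le_div_iff₀ hL2]
      refine mul_le_mul_of_nonneg_left ?_ hn0.le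
      nlinarith
    refine ⟨1, le_rfl, by simpa using hnR, ?_⟩
    norm_num
    linarith
  rcases lt_or_ge n 16 with h16 | h16
  · have h4' : (4 : ℝ) ≤ n := by exact_mod_cast h4
    have h16' : (n : ℝ) ≤ 2 ^ 4 := by norm_num; exact_mod_cast h16.le
    have hLge : 2 ≤ L := by simpa using hmono 2 (by norm_num; exact_mod_cast h4)
    have hLle : L ≤ 4 := by simpa using hmono' 4 h16'
    have hch := chord_le_logb_two (a := 2) (b := 4) (x := L) (by norm_num) (by norm_num)
      hl1 hl4 hLge hLle
    rw [← hl] at hch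
    have hR2 : 2 * n / L ≤ R := by
      rw [hR, div_le_div_iff₀ hL0 hL2]
      have : L * 2 * L ≤ L * (L + 2 * l) := by nlinarith
      nlinarith
    refine ⟨2, by norm_num, le_trans ?_ hR2, ?_⟩
    · rw [div_le_div_iff₀ (by norm_num) hL0]
      push_cast
      nlinarith
    · have h3 : 3 ≤ 2 * n / L := by
        rw [le_div_iff₀ hL0]
        rcases le_or_gt n 8 with h8 | h8
        · have h8' : (n : ℝ) ≤ 2 ^ 3 := by norm_num; exact_mod_cast h8
          have hL3 : L ≤ 3 := by simpa using hmono' 3 h8'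
          rcases Nat.lt_or_ge n 5 with h5 | h5
          · have h5' : (n : ℝ) ≤ 2 ^ 2 := by norm_num; exact_mod_cast Nat.le_of_lt_succ h5
            have hL2' : L ≤ 2 := by simpa using hmono' 2 h5'
            linarith
          · have : (5 : ℝ) ≤ n := by exact_mod_cast h5
            linarith
        · have : (8 : ℝ) < n := by exact_mod_cast h8
          linarith
      norm_num
      linarith
  · have hL4 : 4 ≤ L := by simpa using hmono 4 (by norm_num; exact_mod_cast h16)
    have hl2 : 2 ≤ l := by
      rw [← hl4, hl]
      exact logb_le_logb_of_le (by norm_num) (by norm_num) hL4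
    have hlL : 2 * l ≤ L := two_mul_logb_two_le hL4
    have hpowl : (2 : ℝ) ^ l = L := rpow_logb (by norm_num) (by norm_num) hL0
    set t := 2 * l / L with ht
    have ht0 : 0 ≤ t := by positivity
    have ht1 : t ≤ 1 := by rw [ht, div_le_one hL0]; exact hlL
    have htL : t * L = 2 * l := by rw [ht]; field_simp
    have hRt : R = n / L * (1 + t) := by
      rw [hR, ht]
      field_simp
    have hchord : t ≤ logb 2 (1 + t) := by
      have := chord_le_logb_two (a := 1) (b := 2) (x := 1 + t) (by norm_num) (by norm_num)
        logb_one hl1 (by linarith) (by linarith)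
      linarith
    have hq : 0 < L / (1 + t) := by positivity
    refine ⟨⌈L / (1 + t)⌉₊, Nat.ceil_pos.2 hq, ?_, ?_⟩
    · have hR0 : R = n / (L / (1 + t)) := by
        rw [hRt]
        field_simp
      rw [hR0]
      exact div_le_div_of_nonneg_left hn0.le hq (Nat.le_ceil _)
    · have hs : ((⌈L / (1 + t)⌉₊ : ℕ) : ℝ) ≤ L - l + logb 2 (1 + t) := by
        have hc := Nat.ceil_lt_add_one hq.le
        have hkey : L / (1 + t) + 1 ≤ L - l + t := by
          rw [← le_sub_iff_add_le, div_le_iff₀ (by linarith)]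
          nlinarith [mul_nonneg (sub_nonneg.2 ht1) (sub_nonneg.2 (show 1 + t ≤ l by linarith))]
        linarith
      have hb : (2 : ℝ) ^ ((⌈L / (1 + t)⌉₊ : ℕ) : ℝ) ≤ R := by
        refine (rpow_le_rpow_of_exponent_le (by norm_num) hs).trans (le_of_eq ?_)
        rw [rpow_add (by norm_num), rpow_sub (by norm_num), hpow, hpowl,
          rpow_logb (by norm_num) (by norm_num) (by linarith), hRt]
      rw [rpow_natCast] at hb
      linarith

end PaperLD

/-- For all `n ≥ 2` and `2 ≤ k ≤ n`,
`ldim(Q(n; 1, k)) ≤ n/log n + 2n·log log n/(log n)² + 3` (logs base 2). -/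
theorem stmt17 (n k : ℕ) (hn : 2 ≤ n) (hk2 : 2 ≤ k) (hkn : k ≤ n) :
    (ldim (BoolLayers n 1 k) : ℝ) ≤
      (n : ℝ) / Real.logb 2 n +
        2 * n * Real.logb 2 (Real.logb 2 n) / (Real.logb 2 n) ^ 2 + 3 := by
  obtain ⟨s, hs, hdiv, hpow⟩ := exists_block_length n hn _ rfl
  have hn0 : (0 : ℝ) < Real.logb 2 n :=
    Real.logb_pos (by norm_num) (by exact_mod_cast (show 1 < n by omega))
  have hld : (ldim (BoolLayers n 1 k) : ℝ) ≤ 2 + max ((n / s : ℕ) + 1 : ℝ) (2 ^ s) := by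
    exact_mod_cast ldim_boolLayers_one_le n k s hk2 hs
  have hfloor : ((n / s : ℕ) : ℝ) ≤ n / s := Nat.cast_div_le
  have hR : (n : ℝ) / Real.logb 2 n +
      2 * n * Real.logb 2 (Real.logb 2 n) / (Real.logb 2 n) ^ 2 =
      n * (Real.logb 2 n + 2 * Real.logb 2 (Real.logb 2 n)) / (Real.logb 2 n) ^ 2 := by
    field_simp
  rw [hR]
  have hmax := max_le (add_le_add_left (hfloor.trans hdiv) 1) hpow
  linarith
end
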